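/- arXiv:2605.28692 — 3 statements merged into one kernel-verified Lean document; each statement's English description precedes it below -/
import Mathlib

section
/- Lower bound of Proposition 1 (reduced cost bounds): For every bucket partition 𝓑, if a feasible path exists, then an optimistically feasible selection exists and the optimistic value satisfies cOpt 𝓑 ≤ min over feasible paths p of ∑ i, c i (p i). -/
/-- Lower bound of Proposition 1 (reduced cost bounds): for every bucket partition `𝓑`,
if a feasible path exists, then an optimistically feasible selection exists and the
optimistic value `cOpt 𝓑` is at most the minimum cost over feasible paths. -/
theorem stmt_1
    (n d : ℕ) (hn : 1 ≤ n)
    (S : Fin n → Type) [∀ i, Fintype (S i)] [∀ i, Nonempty (S i)]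
    (c : ∀ i, S i → ℝ) (t : ∀ i, S i → Fin d → ℤ)
    (Feas : (Fin n → Fin d → ℤ) → Prop)
    (hFeas : IsLowerSet {v : Fin n → Fin d → ℤ | Feas v})
    (𝓑 : Fin n → Finset ((Fin d → ℤ) × (Fin d → ℤ)))
    (hdisj : ∀ i, ∀ B ∈ 𝓑 i, ∀ B' ∈ 𝓑 i, B ≠ B' →
      Disjoint (Set.Icc B.1 B.2) (Set.Icc B'.1 B'.2))
    (hcover : ∀ i (σ : S i), ∃ B ∈ 𝓑 i, t i σ ∈ Set.Icc B.1 B.2)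
    (rep : ∀ i, (Fin d → ℤ) × (Fin d → ℤ) → S i)
    (hrep_mem : ∀ (i : Fin n) (B : (Fin d → ℤ) × (Fin d → ℤ)),
      (∃ σ : S i, t i σ ∈ Set.Icc B.1 B.2) → t i (rep i B) ∈ Set.Icc B.1 B.2)
    (hrep_min : ∀ (i : Fin n) (B : (Fin d → ℤ) × (Fin d → ℤ)),
      (∃ σ : S i, t i σ ∈ Set.Icc B.1 B.2) →
      ∀ σ : S i, t i σ ∈ Set.Icc B.1 B.2 → c i (rep i B) ≤ c i σ)
    -- a feasible path exists
    (p : ∀ i, S i) (hp : Feas (fun i => t i (p i))) :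
    (∃ b : Fin n → (Fin d → ℤ) × (Fin d → ℤ),
      (∀ i, b i ∈ 𝓑 i) ∧ (∀ i, ∃ σ : S i, t i σ ∈ Set.Icc (b i).1 (b i).2) ∧
      Feas (fun i => (b i).1)) ∧
    sInf {x : ℝ | ∃ b : Fin n → (Fin d → ℤ) × (Fin d → ℤ),
        (∀ i, b i ∈ 𝓑 i) ∧ (∀ i, ∃ σ : S i, t i σ ∈ Set.Icc (b i).1 (b i).2) ∧
        Feas (fun i => (b i).1) ∧ x = ∑ i, c i (rep i (b i))} ≤
      sInf {x : ℝ | ∃ q : ∀ i, S i, Feas (fun i => t i (q i)) ∧ x = ∑ i, c i (q i)} := by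
  have exists_selection (q : ∀ i, S i) (hq : Feas (fun i => t i (q i))) :
      ∃ b : Fin n → (Fin d → ℤ) × (Fin d → ℤ), (∀ i, b i ∈ 𝓑 i) ∧
        (∀ i, t i (q i) ∈ Set.Icc (b i).1 (b i).2) ∧ Feas (fun i => (b i).1) := by
    choose b hb hmem using fun i => hcover i (q i)
    exact ⟨b, hb, hmem, hFeas (fun i => (hmem i).1) hq⟩
  refine ⟨?_, le_csInf ⟨_, p, hp, rfl⟩ ?_⟩
  · obtain ⟨b, hb, hmem, hfeas⟩ := exists_selection p hp
    exact ⟨b, hb, fun i => ⟨p i, hmem i⟩, hfeas⟩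
  · rintro _ ⟨q, hq, rfl⟩
    obtain ⟨b, hb, hmem, hfeas⟩ := exists_selection q hq
    have hbdd : BddBelow (Set.range fun r : ∀ i, S i => ∑ i, c i (r i)) :=
      (Set.finite_range _).bddBelow
    refine le_trans (csInf_le (hbdd.mono ?_) ⟨b, hb, fun i => ⟨q i, hmem i⟩, hfeas, rfl⟩)
      (Finset.sum_le_sum fun i _ => hrep_min i (b i) ⟨q i, hmem i⟩ (q i) (hmem i))
    rintro _ ⟨b', -, -, -, rfl⟩
    exact ⟨fun i => rep i (b' i), rfl⟩
end

section
/- Proposition 2, optimistic part (monotonicity under refinement): If 𝓑' is a refinement of 𝓑, then for every optimistically feasible selection b' of 𝓑' there exists an optimistically feasible selection b of 𝓑 with ∑ i, c i (rep (b i)) ≤ ∑ i, c i (rep (b' i)). Consequently, if an optimistically feasible selection exists for 𝓑', then one exists for 𝓑 and cOpt 𝓑 ≤ cOpt 𝓑'. -/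
/-- Proposition 2, optimistic part (monotonicity under refinement): if `𝓑'` refines `𝓑`,
every optimistically feasible selection `b'` of `𝓑'` induces an optimistically feasible
selection `b` of `𝓑` with `∑ i, c i (rep (b i)) ≤ ∑ i, c i (rep (b' i))`; consequently
`cOpt 𝓑 ≤ cOpt 𝓑'`. -/
theorem stmt_5
    (n d : ℕ) (hn : 1 ≤ n)
    (S : Fin n → Type) [∀ i, Fintype (S i)] [∀ i, Nonempty (S i)]
    (c : ∀ i, S i → ℝ) (t : ∀ i, S i → Fin d → ℤ)
    (Feas : (Fin n → Fin d → ℤ) → Prop)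
    (hFeas : IsLowerSet {v : Fin n → Fin d → ℤ | Feas v})
    -- bucket partition 𝓑
    (𝓑 : Fin n → Finset ((Fin d → ℤ) × (Fin d → ℤ)))
    (hdisj : ∀ i, ∀ B ∈ 𝓑 i, ∀ B' ∈ 𝓑 i, B ≠ B' →
      Disjoint (Set.Icc B.1 B.2) (Set.Icc B'.1 B'.2))
    (hcover : ∀ i (σ : S i), ∃ B ∈ 𝓑 i, t i σ ∈ Set.Icc B.1 B.2)
    -- bucket partition 𝓑'
    (𝓑' : Fin n → Finset ((Fin d → ℤ) × (Fin d → ℤ)))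
    (hdisj' : ∀ i, ∀ B ∈ 𝓑' i, ∀ B' ∈ 𝓑' i, B ≠ B' →
      Disjoint (Set.Icc B.1 B.2) (Set.Icc B'.1 B'.2))
    (hcover' : ∀ i (σ : S i), ∃ B ∈ 𝓑' i, t i σ ∈ Set.Icc B.1 B.2)
    -- 𝓑' is a refinement of 𝓑
    (href_sub : ∀ i, ∀ B' ∈ 𝓑' i, ∃ B ∈ 𝓑 i, Set.Icc B'.1 B'.2 ⊆ Set.Icc B.1 B.2)
    (href_union : ∀ i, (⋃ B' ∈ 𝓑' i, Set.Icc B'.1 B'.2) = ⋃ B ∈ 𝓑 i, Set.Icc B.1 B.2)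
    -- representatives
    (rep : ∀ i, (Fin d → ℤ) × (Fin d → ℤ) → S i)
    (hrep_mem : ∀ (i : Fin n) (B : (Fin d → ℤ) × (Fin d → ℤ)),
      (∃ σ : S i, t i σ ∈ Set.Icc B.1 B.2) → t i (rep i B) ∈ Set.Icc B.1 B.2)
    (hrep_min : ∀ (i : Fin n) (B : (Fin d → ℤ) × (Fin d → ℤ)),
      (∃ σ : S i, t i σ ∈ Set.Icc B.1 B.2) →
      ∀ σ : S i, t i σ ∈ Set.Icc B.1 B.2 → c i (rep i B) ≤ c i σ) :
    (∀ b' : Fin n → (Fin d → ℤ) × (Fin d → ℤ),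
      (∀ i, b' i ∈ 𝓑' i) → (∀ i, ∃ σ : S i, t i σ ∈ Set.Icc (b' i).1 (b' i).2) →
      Feas (fun i => (b' i).1) →
      ∃ b : Fin n → (Fin d → ℤ) × (Fin d → ℤ),
        (∀ i, b i ∈ 𝓑 i) ∧ (∀ i, ∃ σ : S i, t i σ ∈ Set.Icc (b i).1 (b i).2) ∧
        Feas (fun i => (b i).1) ∧
        ∑ i, c i (rep i (b i)) ≤ ∑ i, c i (rep i (b' i))) ∧
    ((∃ b' : Fin n → (Fin d → ℤ) × (Fin d → ℤ),
        (∀ i, b' i ∈ 𝓑' i) ∧ (∀ i, ∃ σ : S i, t i σ ∈ Set.Icc (b' i).1 (b' i).2) ∧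
        Feas (fun i => (b' i).1)) →
      (∃ b : Fin n → (Fin d → ℤ) × (Fin d → ℤ),
        (∀ i, b i ∈ 𝓑 i) ∧ (∀ i, ∃ σ : S i, t i σ ∈ Set.Icc (b i).1 (b i).2) ∧
        Feas (fun i => (b i).1)) ∧
      sInf {x : ℝ | ∃ b : Fin n → (Fin d → ℤ) × (Fin d → ℤ),
          (∀ i, b i ∈ 𝓑 i) ∧ (∀ i, ∃ σ : S i, t i σ ∈ Set.Icc (b i).1 (b i).2) ∧
          Feas (fun i => (b i).1) ∧ x = ∑ i, c i (rep i (b i))} ≤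
        sInf {x : ℝ | ∃ b' : Fin n → (Fin d → ℤ) × (Fin d → ℤ),
          (∀ i, b' i ∈ 𝓑' i) ∧ (∀ i, ∃ σ : S i, t i σ ∈ Set.Icc (b' i).1 (b' i).2) ∧
          Feas (fun i => (b' i).1) ∧ x = ∑ i, c i (rep i (b' i))}) := by
  have key : ∀ b' : Fin n → (Fin d → ℤ) × (Fin d → ℤ),
      (∀ i, b' i ∈ 𝓑' i) → (∀ i, ∃ σ : S i, t i σ ∈ Set.Icc (b' i).1 (b' i).2) →
      Feas (fun i => (b' i).1) →
      ∃ b : Fin n → (Fin d → ℤ) × (Fin d → ℤ),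
        (∀ i, b i ∈ 𝓑 i) ∧ (∀ i, ∃ σ : S i, t i σ ∈ Set.Icc (b i).1 (b i).2) ∧
        Feas (fun i => (b i).1) ∧
        ∑ i, c i (rep i (b i)) ≤ ∑ i, c i (rep i (b' i)) := by
    intro b' hb' hne hfeas
    choose b hb hsub using fun i => href_sub i (b' i) (hb' i)
    have hne_b : ∀ i, ∃ σ : S i, t i σ ∈ Set.Icc (b i).1 (b i).2 := fun i =>
      (hne i).imp fun σ hσ => hsub i hσ
    have hlo : ∀ i, (b i).1 ≤ (b' i).1 := fun i => by
      obtain ⟨σ, hσ⟩ := hne i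
      exact (hsub i (Set.left_mem_Icc.2 (hσ.1.trans hσ.2))).1
    exact ⟨b, hb, hne_b, hFeas (show (fun i => (b i).1) ≤ fun i => (b' i).1 from hlo) hfeas,
      Finset.sum_le_sum fun i _ =>
        hrep_min i (b i) (hne_b i) _ (hsub i (hrep_mem i (b' i) (hne i)))⟩
  refine ⟨key, ?_⟩
  rintro ⟨b', hb', hne, hfeas⟩
  refine ⟨?_, ?_⟩
  · obtain ⟨b, hb, hne_b, hfeas_b, -⟩ := key b' hb' hne hfeas
    exact ⟨b, hb, hne_b, hfeas_b⟩
  · choose m hm using fun i => Finite.exists_min (c i)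
    refine le_csInf ⟨_, b', hb', hne, hfeas, rfl⟩ ?_
    rintro _ ⟨a', ha', hne_a', hfeas_a', rfl⟩
    obtain ⟨a, ha, hne_a, hfeas_a, hle⟩ := key a' ha' hne_a' hfeas_a'
    refine le_trans (csInf_le ⟨∑ i, c i (m i), ?_⟩ ⟨a, ha, hne_a, hfeas_a, rfl⟩) hle
    rintro _ ⟨e, -, -, -, rfl⟩
    exact Finset.sum_le_sum fun i _ => hm i _
end

section
/- Merged-bucket optimistic value identity (correctness of the bucket merging criterion): Fix a block i₀, a bucket partition 𝓑, and nonempty buckets B, B' ∈ 𝓑 i₀ with lo B ≤ lo B' pointwise. Let M be an integer box with lo M = lo B, and suppose the subpaths of block i₀ with contribution in M are exactly those with contribution in B together with those with contribution in B'; let repM be a minimum-cost subpath of block i₀ with contribution in M. Then c i₀ repM = c i₀ (rep B) + min 0 (c i₀ (rep B') − c i₀ (rep B)). Moreover, writing cOptThrough(𝓑, B) for the minimum of ∑ i, c i (rep (b i)) over optimistically feasible selections b with b i₀ = B, and assuming such a selection exists, the minimum of c i₀ repM + ∑_{i ≠ i₀} c i (rep (b i)) over families b of nonempty buckets (b i ∈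 𝓑 i for i ≠ i₀) with Feas (fun i => if i = i₀ then lo M else lo (b i)) equals cOptThrough(𝓑, B) + min 0 (c i₀ (rep B') − c i₀ (rep B)). -/
/-- Merged-bucket optimistic value identity (correctness of the bucket merging criterion):
for adjacent nonempty buckets `B, B' ∈ 𝓑 i₀` with `lo B ≤ lo B'`, a merged box `M` with
`lo M = lo B` whose subpaths are exactly those of `B` and `B'`, and a minimum-cost subpath
`repM` of `M`, we have `c repM = c (rep B) + min 0 (c (rep B') - c (rep B))`, and the
optimistic value through the merged bucket equals
`cOptThrough(𝓑, B) + min 0 (c (rep B') - c (rep B))`. -/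
theorem stmt_14
    (n d : ℕ) (hn : 1 ≤ n)
    (S : Fin n → Type) [∀ i, Fintype (S i)] [∀ i, Nonempty (S i)]
    (c : ∀ i, S i → ℝ) (t : ∀ i, S i → Fin d → ℤ)
    (Feas : (Fin n → Fin d → ℤ) → Prop)
    (hFeas : IsLowerSet {v : Fin n → Fin d → ℤ | Feas v})
    (𝓑 : Fin n → Finset ((Fin d → ℤ) × (Fin d → ℤ)))
    (hdisj : ∀ i, ∀ B ∈ 𝓑 i, ∀ B' ∈ 𝓑 i, B ≠ B' →
      Disjoint (Set.Icc B.1 B.2) (Set.Icc B'.1 B'.2))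
    (hcover : ∀ i (σ : S i), ∃ B ∈ 𝓑 i, t i σ ∈ Set.Icc B.1 B.2)
    (rep : ∀ i, (Fin d → ℤ) × (Fin d → ℤ) → S i)
    (hrep_mem : ∀ (i : Fin n) (B : (Fin d → ℤ) × (Fin d → ℤ)),
      (∃ σ : S i, t i σ ∈ Set.Icc B.1 B.2) → t i (rep i B) ∈ Set.Icc B.1 B.2)
    (hrep_min : ∀ (i : Fin n) (B : (Fin d → ℤ) × (Fin d → ℤ)),
      (∃ σ : S i, t i σ ∈ Set.Icc B.1 B.2) →
      ∀ σ : S i, t i σ ∈ Set.Icc B.1 B.2 → c i (rep i B) ≤ c i σ)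
    -- the fixed block and the two nonempty buckets to be merged
    (i₀ : Fin n)
    (B B' : (Fin d → ℤ) × (Fin d → ℤ)) (hB : B ∈ 𝓑 i₀) (hB' : B' ∈ 𝓑 i₀)
    (hBne : ∃ σ : S i₀, t i₀ σ ∈ Set.Icc B.1 B.2)
    (hB'ne : ∃ σ : S i₀, t i₀ σ ∈ Set.Icc B'.1 B'.2)
    (hlo : B.1 ≤ B'.1)
    -- the merged box M, with lo M = lo B, containing exactly the subpaths of B and B'
    (M : (Fin d → ℤ) × (Fin d → ℤ)) (hMlo : M.1 = B.1)
    (hM : ∀ σ : S i₀, t i₀ σ ∈ Set.Icc M.1 M.2 ↔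
      (t i₀ σ ∈ Set.Icc B.1 B.2 ∨ t i₀ σ ∈ Set.Icc B'.1 B'.2))
    -- a minimum-cost subpath of the merged box
    (repM : S i₀)
    (hrepM_mem : t i₀ repM ∈ Set.Icc M.1 M.2)
    (hrepM_min : ∀ σ : S i₀, t i₀ σ ∈ Set.Icc M.1 M.2 → c i₀ repM ≤ c i₀ σ)
    -- an optimistically feasible selection through B exists
    (hex : ∃ b : Fin n → (Fin d → ℤ) × (Fin d → ℤ),
      (∀ i, b i ∈ 𝓑 i) ∧ (∀ i, ∃ σ : S i, t i σ ∈ Set.Icc (b i).1 (b i).2) ∧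
      Feas (fun i => (b i).1) ∧ b i₀ = B) :
    c i₀ repM = c i₀ (rep i₀ B) + min 0 (c i₀ (rep i₀ B') - c i₀ (rep i₀ B)) ∧
    sInf {x : ℝ | ∃ b : Fin n → (Fin d → ℤ) × (Fin d → ℤ),
        (∀ i, i ≠ i₀ → b i ∈ 𝓑 i ∧ ∃ σ : S i, t i σ ∈ Set.Icc (b i).1 (b i).2) ∧
        Feas (fun i => if i = i₀ then M.1 else (b i).1) ∧
        x = c i₀ repM + ∑ i ∈ Finset.univ.erase i₀, c i (rep i (b i))} =
      sInf {x : ℝ | ∃ b : Fin n → (Fin d → ℤ) × (Fin d → ℤ),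
          (∀ i, b i ∈ 𝓑 i) ∧ (∀ i, ∃ σ : S i, t i σ ∈ Set.Icc (b i).1 (b i).2) ∧
          Feas (fun i => (b i).1) ∧ b i₀ = B ∧ x = ∑ i, c i (rep i (b i))} +
        min 0 (c i₀ (rep i₀ B') - c i₀ (rep i₀ B)) := by
  have hcost : c i₀ repM = c i₀ (rep i₀ B) + min 0 (c i₀ (rep i₀ B') - c i₀ (rep i₀ B)) := by
    have hle := hrepM_min _ ((hM _).2 (Or.inl (hrep_mem i₀ B hBne)))
    have hle' := hrepM_min _ ((hM _).2 (Or.inr (hrep_mem i₀ B' hB'ne)))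
    rw [← min_add_add_left, add_zero, add_sub_cancel]
    refine le_antisymm (le_min hle hle') ?_
    rcases (hM repM).1 hrepM_mem with h | h
    · exact (min_le_left _ _).trans (hrep_min i₀ B hBne repM h)
    · exact (min_le_right _ _).trans (hrep_min i₀ B' hB'ne repM h)
  refine ⟨hcost, ?_⟩
  rw [hcost]
  set δ := min 0 (c i₀ (rep i₀ B') - c i₀ (rep i₀ B))
  rw [← OrderIso.addRight_apply δ (sInf _), OrderIso.map_csInf']
  · congr 1
    ext x
    constructor
    · rintro ⟨b, hb, hfeas, rfl⟩
      refine ⟨∑ i, c i (rep i (Function.update b i₀ B i)),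
        ⟨Function.update b i₀ B, fun i => ?_, fun i => ?_, ?_, by simp, rfl⟩, ?_⟩
      · rcases eq_or_ne i i₀ with rfl | h
        · simpa using hB
        · simpa [h] using (hb i h).1
      · rcases eq_or_ne i i₀ with rfl | h
        · simpa using hBne
        · simpa [h] using (hb i h).2
      · convert hfeas using 2 with i
        rcases eq_or_ne i i₀ with rfl | h
        · simp [hMlo]
        · simp [h]
      · rw [OrderIso.addRight_apply, ← Finset.add_sum_erase _ _ (Finset.mem_univ i₀),
          Function.update_self, add_right_comm]
        congr 1
        refine Finset.sum_congr rfl fun i hi => ?_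
        rw [Function.update_of_ne (Finset.ne_of_mem_erase hi)]
    · rintro ⟨_, ⟨b, hb, hne, hfeas, rfl, rfl⟩, rfl⟩
      refine ⟨b, fun i _ => ⟨hb i, hne i⟩, ?_, ?_⟩
      · convert hfeas using 2 with i
        rcases eq_or_ne i i₀ with rfl | h
        · simp [hMlo]
        · simp [h]
      · rw [OrderIso.addRight_apply, ← Finset.add_sum_erase _ _ (Finset.mem_univ i₀),
          add_right_comm]
  · obtain ⟨b, hb, hne, hfeas, hbB⟩ := hex
    exact ⟨_, b, hb, hne, hfeas, hbB, rfl⟩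
  · refine ((Set.finite_range fun s : ∀ i, S i => ∑ i, c i (s i)).subset ?_).bddBelow
    rintro _ ⟨b, -, -, -, -, rfl⟩
    exact ⟨fun i => rep i (b i), rfl⟩
end
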